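/- Let F = (f_1,…,f_n) be an O-M system on B and S the common zero set of f_1,…,f_{n-1}. Suppose S ∩ ∂B = {p₁, p₂} with p₁ ≠ p₂. If f_n(p₁)·f_n(p₂) ≤ 0, then F has exactly one zero in B: there is a unique point p ∈ B with f_1(p) = ⋯ = f_n(p) = 0. -/

import Mathlib

/-- The partial derivative `∂f/∂x_i` at `p`. -/
noncomputable def pd {m : ℕ} (f : (Fin m → ℝ) → ℝ) (i : Fin m) (p : Fin m → ℝ) : ℝ :=
  fderiv ℝ f p (Pi.single i 1)

/-- `f` is continuously differentiable on an open set containing `B`. -/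
def C1On {m : ℕ} (f : (Fin m → ℝ) → ℝ) (B : Set (Fin m → ℝ)) : Prop :=
  ∃ U : Set (Fin m → ℝ), IsOpen U ∧ B ⊆ U ∧ ContDiffOn ℝ 1 f U

/-- `M` is an admissible `i`-minor of the family `g = (g_1, …, g_{n+1})` of
functions on `ℝ^{n+2}` over `B`: there are points `q j ∈ B` with
`M j k = (∂ g_j / ∂ x_{c k})(q j)`, where `c = i.succAbove` is the increasing
enumeration of the complement of `{i}` in `Fin (n+2)`. -/
def AdmMinor (n : ℕ) (g : Fin (n+1) → (Fin (n+2) → ℝ) → ℝ) (B : Set (Fin (n+2) → ℝ))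
    (i : Fin (n+2)) (M : Matrix (Fin (n+1)) (Fin (n+1)) ℝ) : Prop :=
  ∃ q : Fin (n+1) → (Fin (n+2) → ℝ), (∀ j, q j ∈ B) ∧
    ∀ j k, M j k = pd (g j) (i.succAbove k) (q j)

/-- The family `(g_1, …, g_{n+1})` is strongly monotone on `B`: every admissible
`i`-minor over `B` has nonzero determinant, for every `i`. -/
def StrongMono (n : ℕ) (g : Fin (n+1) → (Fin (n+2) → ℝ) → ℝ)
    (B : Set (Fin (n+2) → ℝ)) : Prop :=
  ∀ (i : Fin (n+2)) (M : Matrix (Fin (n+1)) (Fin (n+1)) ℝ), AdmMinor n g B i M → M.det ≠ 0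

/-- `F = (f_1,…,f_n)` (with `n = n'+2`, 0-based indices) is an O-M system on `B`:
(1) the first `n-1` components are strongly monotone on `B`, and (2) for all
indices `i, j`, admissible minors `Mi, Mj` of the first `n-1` components, and
points `p, q ∈ B`, the quantities `(−1)^{i+n}·det Mi·(∂f_n/∂x_i)(p)` and
`(−1)^{j+n}·det Mj·(∂f_n/∂x_j)(q)` have the same (nonzero) sign.  With 0-based
indices the paper's exponent `i+n` becomes `i.val + n' + 1 (mod 2)`. -/
def OMSystem (n : ℕ) (f : Fin (n+2) → (Fin (n+2) → ℝ) → ℝ)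
    (B : Set (Fin (n+2) → ℝ)) : Prop :=
  StrongMono n (fun j : Fin (n+1) => f j.castSucc) B ∧
  ∀ (i j : Fin (n+2)) (Mi Mj : Matrix (Fin (n+1)) (Fin (n+1)) ℝ),
    AdmMinor n (fun j : Fin (n+1) => f j.castSucc) B i Mi →
    AdmMinor n (fun j : Fin (n+1) => f j.castSucc) B j Mj →
    ∀ p q : Fin (n+2) → ℝ, p ∈ B → q ∈ B →
      ((-1 : ℝ) ^ ((i : ℕ) + n + 1) * Mi.det * pd (f (Fin.last (n+1))) i p) *
        ((-1 : ℝ) ^ ((j : ℕ) + n + 1) * Mj.det * pd (f (Fin.last (n+1))) j q) > 0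

open Filter Topology in
/-- A differentiable curve whose velocity points, in each coordinate, towards a point of the box
stays in the box for small positive times. -/
theorem eventually_mem_Icc_of_hasDerivAt {ι : Type*} [Fintype ι] {a b x y v : ι → ℝ}
    {γ : ℝ → ι → ℝ} (hγ : HasDerivAt γ v 0) (h0 : γ 0 = x)
    (hx : x ∈ Set.Icc a b) (hy : y ∈ Set.Icc a b) (hv : ∀ i, 0 < v i * (y i - x i)) :
    ∀ᶠ t in 𝓝[>] (0 : ℝ), γ t ∈ Set.Icc a b := by
  have key : ∀ i, ∀ᶠ t in 𝓝[>] (0 : ℝ), a i ≤ γ t i ∧ γ t i ≤ b i := by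
    intro i
    have hd : HasDerivAt (fun t => γ t i) (v i) 0 := (hasDerivAt_pi.1 hγ) i
    have hslope : Tendsto (slope (fun t => γ t i) 0) (𝓝[>] 0) (𝓝 (v i)) :=
      (hasDerivAt_iff_tendsto_slope.1 hd).mono_left
        (nhdsWithin_mono _ fun t (ht : 0 < t) => ht.ne')
    have hcont : Tendsto (fun t => γ t i) (𝓝[>] 0) (𝓝 (x i)) := by
      have := hd.continuousAt.tendsto
      rw [h0] at this
      exact this.mono_left nhdsWithin_le_nhds
    rcases pos_and_pos_or_neg_and_neg_of_mul_pos (hv i) with ⟨hvi, hxy⟩ | ⟨hvi, hxy⟩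
    · filter_upwards [hslope.eventually_const_lt hvi,
        hcont.eventually_lt_const (show x i < b i by linarith [hy.2 i]),
        self_mem_nhdsWithin] with t h1 h2 ht
      rw [slope_def_field, sub_zero, h0, div_pos_iff_of_pos_right ht] at h1
      exact ⟨by linarith [hx.1 i], h2.le⟩
    · filter_upwards [hslope.eventually_lt_const hvi,
        hcont.eventually_const_lt (show a i < x i by linarith [hy.1 i]),
        self_mem_nhdsWithin] with t h1 h2 ht
      rw [slope_def_field, sub_zero, h0, div_neg_iff] at h1
      have ht' : 0 < t := ht
      rcases h1 with ⟨-, h⟩ | ⟨h, -⟩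
      · linarith
      · exact ⟨h2.le, by linarith [hx.2 i]⟩
  filter_upwards [eventually_all.2 key] with t ht
  exact ⟨fun i => (ht i).1, fun i => (ht i).2⟩

theorem fderiv_apply_eq_sum_pd {m : ℕ} (f : (Fin m → ℝ) → ℝ) (z v : Fin m → ℝ) :
    fderiv ℝ f z v = ∑ k, pd f k z * v k := by
  rw [← ContinuousLinearMap.coe_coe, LinearMap.pi_apply_eq_sum_univ]
  refine Finset.sum_congr rfl fun k _ => ?_
  simp only [pd, ContinuousLinearMap.coe_coe, smul_eq_mul]
  rw [mul_comm]
  congr 2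
  ext j
  simp [Pi.single_apply, eq_comm]

theorem C1On.contDiffAt {m : ℕ} {f : (Fin m → ℝ) → ℝ} {B : Set (Fin m → ℝ)} (h : C1On f B)
    {x : Fin m → ℝ} (hx : x ∈ B) : ContDiffAt ℝ 1 f x := by
  obtain ⟨U, hU, hBU, hf⟩ := h
  exact hf.contDiffAt (hU.mem_nhds (hBU hx))

theorem C1On.continuousOn {m : ℕ} {f : (Fin m → ℝ) → ℝ} {B : Set (Fin m → ℝ)}
    (h : C1On f B) : ContinuousOn f B :=
  fun _ hx => (h.contDiffAt hx).continuousAt.continuousWithinAt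

/-- The mean value theorem in terms of partial derivatives. -/
theorem C1On.exists_sub_eq_sum_pd {m : ℕ} {f : (Fin m → ℝ) → ℝ} {B : Set (Fin m → ℝ)}
    (h : C1On f B) (hB : Convex ℝ B) {x y : Fin m → ℝ} (hx : x ∈ B) (hy : y ∈ B) :
    ∃ z ∈ B, f y - f x = ∑ k, pd f k z * (y - x) k := by
  obtain ⟨z, hz, hzeq⟩ := domain_mvt (f' := fun z => fderiv ℝ f z)
    (fun w hw => ((h.contDiffAt hw).differentiableAt one_ne_zero).hasFDerivAt.hasFDerivWithinAt)
    hB hx hy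
  exact ⟨z, hB.segment_subset hx hy hz, by rw [hzeq, fderiv_apply_eq_sum_pd]⟩

/-- The Jacobian matrix of `f` with row `r` evaluated at its own point `q r`. -/
noncomputable def mixedJacobian {m : ℕ} (f : Fin m → (Fin m → ℝ) → ℝ) (q : Fin m → Fin m → ℝ) :
    Matrix (Fin m) (Fin m) ℝ :=
  Matrix.of fun r k => pd (f r) k (q r)

theorem exists_mixedJacobian_mulVec_sub {m : ℕ} {f : Fin m → (Fin m → ℝ) → ℝ}
    {B : Set (Fin m → ℝ)} (hf : ∀ j, C1On (f j) B) (hB : Convex ℝ B) {x y : Fin m → ℝ}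
    (hx : x ∈ B) (hy : y ∈ B) :
    ∃ q : Fin m → Fin m → ℝ, (∀ r, q r ∈ B) ∧
      (mixedJacobian f q).mulVec (y - x) = fun j => f j y - f j x := by
  choose q hq hqe using fun j => (hf j).exists_sub_eq_sum_pd hB hx hy
  exact ⟨q, hq, funext fun j => (hqe j).symm⟩

namespace OMSystem

variable {n : ℕ} {f : Fin (n + 2) → (Fin (n + 2) → ℝ) → ℝ} {B : Set (Fin (n + 2) → ℝ)}

theorem admMinor_submatrix {q : Fin (n + 2) → Fin (n + 2) → ℝ} (hq : ∀ r, q r ∈ B)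
    (i : Fin (n + 2)) :
    AdmMinor n (fun j : Fin (n + 1) => f j.castSucc) B i
      ((mixedJacobian f q).submatrix (Fin.last (n + 1)).succAbove i.succAbove) :=
  ⟨fun j => q j.castSucc, fun _ => hq _, fun j k => by simp [mixedJacobian]⟩

theorem det_mul_cofactor_mul_pd_pos (h : OMSystem n f B) {q : Fin (n + 2) → Fin (n + 2) → ℝ}
    (hq : ∀ r, q r ∈ B) {p : Fin (n + 2) → ℝ} (hp : p ∈ B) (j : Fin (n + 2)) :
    0 < (mixedJacobian f q).det *
      ((mixedJacobian f q).adjugate j (Fin.last (n + 1)) * pd (f (Fin.last (n + 1))) j p) := by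
  rw [Matrix.adjugate_fin_succ_eq_det_submatrix,
    Matrix.det_succ_row _ (Fin.last (n + 1)), Finset.sum_mul]
  refine Finset.sum_pos (fun i _ => ?_) Finset.univ_nonempty
  have := h.2 i j _ _ (admMinor_submatrix hq i) (admMinor_submatrix hq j)
    (q (Fin.last (n + 1))) p (hq _) hp
  simp only [mixedJacobian, Matrix.of_apply, Fin.val_last] at this ⊢
  refine this.trans_eq ?_
  ring

theorem det_mixedJacobian_ne_zero (h : OMSystem n f B) {q : Fin (n + 2) → Fin (n + 2) → ℝ}
    (hq : ∀ r, q r ∈ B) : (mixedJacobian f q).det ≠ 0 :=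
  left_ne_zero_of_mul (h.det_mul_cofactor_mul_pd_pos hq (hq 0) 0).ne'

theorem mul_pd_pos (h : OMSystem n f B) {q : Fin (n + 2) → Fin (n + 2) → ℝ}
    (hq : ∀ r, q r ∈ B) {v : Fin (n + 2) → ℝ} {c : ℝ} (hc : 0 < c)
    (hv : (mixedJacobian f q).mulVec v = Pi.single (Fin.last (n + 1)) c)
    {p : Fin (n + 2) → ℝ} (hp : p ∈ B) (j : Fin (n + 2)) :
    0 < v j * pd (f (Fin.last (n + 1))) j p := by
  have hdet : (mixedJacobian f q).det * v j =
      (mixedJacobian f q).adjugate j (Fin.last (n + 1)) * c := by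
    have := congrFun (congrArg (mixedJacobian f q).adjugate.mulVec hv) j
    simpa [Matrix.mulVec_mulVec, Matrix.adjugate_mul, Matrix.smul_mulVec, mul_comm] using this
  have hpos := mul_pos hc (h.det_mul_cofactor_mul_pd_pos hq hp j)
  refine pos_of_mul_pos_right (a := (mixedJacobian f q).det ^ 2) ?_ (sq_nonneg _)
  refine hpos.trans_eq ?_
  linear_combination -(mixedJacobian f q).det * pd (f (Fin.last (n + 1))) j p * hdet

theorem injOn (h : OMSystem n f B) (hf : ∀ j, C1On (f j) B) (hB : Convex ℝ B) :
    Set.InjOn (fun x j => f j x) B := by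
  intro x hx y hy hxy
  obtain ⟨q, hq, hqe⟩ := exists_mixedJacobian_mulVec_sub hf hB hx hy
  refine (sub_eq_zero.1 (Matrix.eq_zero_of_mulVec_eq_zero (h.det_mixedJacobian_ne_zero hq)
    (hqe.trans ?_))).symm
  exact funext fun j => sub_eq_zero.2 (congrFun hxy j).symm

open Filter Topology in
/-- Along the common zero set of the first components, the last component can be increased
slightly from `x` without leaving the box, if it takes a larger value elsewhere. -/
theorem eventually_exists_last_eq_add {a b : Fin (n + 2) → ℝ} (h : OMSystem n f (Set.Icc a b))
    (hf : ∀ j, C1On (f j) (Set.Icc a b)) {x y : Fin (n + 2) → ℝ} (hx : x ∈ Set.Icc a b)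
    (hy : y ∈ Set.Icc a b) (hx0 : ∀ j : Fin (n + 1), f j.castSucc x = 0)
    (hy0 : ∀ j : Fin (n + 1), f j.castSucc y = 0)
    (hxy : f (Fin.last (n + 1)) x < f (Fin.last (n + 1)) y) :
    ∀ᶠ t in 𝓝[>] (0 : ℝ), ∃ z ∈ Set.Icc a b, (∀ j : Fin (n + 1), f j.castSucc z = 0) ∧
      f (Fin.last (n + 1)) z = f (Fin.last (n + 1)) x + t := by
  let F' : (Fin (n + 2) → ℝ) →L[ℝ] (Fin (n + 2) → ℝ) :=
    ContinuousLinearMap.pi fun j => fderiv ℝ (f j) x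
  have hF'J : ∀ v, F' v = (mixedJacobian f fun _ => x).mulVec v := fun v =>
    funext fun j => fderiv_apply_eq_sum_pd (f j) x v
  have hinj : Function.Injective (F' : (Fin (n + 2) → ℝ) →ₗ[ℝ] (Fin (n + 2) → ℝ)) := by
    rw [injective_iff_map_eq_zero]
    intro v hv
    exact Matrix.eq_zero_of_mulVec_eq_zero (h.det_mixedJacobian_ne_zero fun _ => hx)
      ((hF'J v).symm.trans hv)
  let A : (Fin (n + 2) → ℝ) ≃L[ℝ] (Fin (n + 2) → ℝ) :=
    (LinearEquiv.ofInjectiveEndo _ hinj).toContinuousLinearEquiv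
  have hF : HasStrictFDerivAt (fun w j => f j w)
      (A : (Fin (n + 2) → ℝ) →L[ℝ] (Fin (n + 2) → ℝ)) x :=
    hasStrictFDerivAt_pi.2 fun j => ((hf j).contDiffAt hx).hasStrictFDerivAt one_ne_zero
  let e : Fin (n + 2) → ℝ := Pi.single (Fin.last (n + 1)) 1
  have hline : HasDerivAt (fun t : ℝ => (fun j => f j x) + t • e) e 0 := by
    simpa using ((hasDerivAt_id (0 : ℝ)).smul_const e).const_add (fun j => f j x)
  have hlinv : HasFDerivAt (hF.localInverse _ _ _)
      (A.symm : (Fin (n + 2) → ℝ) →L[ℝ] (Fin (n + 2) → ℝ))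
      ((fun j => f j x) + (0 : ℝ) • e) := by
    simpa using hF.to_localInverse.hasFDerivAt
  have hγ := hlinv.comp_hasDerivAt (0 : ℝ) hline
  have hγ0 : (hF.localInverse _ _ _ ∘ fun t : ℝ => (fun j => f j x) + t • e) 0 = x := by
    simp
  have hAv : (mixedJacobian f fun _ => x).mulVec (A.symm e) = e := by
    rw [← hF'J]
    exact A.apply_symm_apply e
  obtain ⟨q, hq, hqe⟩ := exists_mixedJacobian_mulVec_sub hf (convex_Icc a b) hx hy
  have hqe' : (mixedJacobian f q).mulVec (y - x) = Pi.single (Fin.last (n + 1))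
      (f (Fin.last (n + 1)) y - f (Fin.last (n + 1)) x) := by
    rw [hqe]
    ext j
    induction j using Fin.lastCases with
    | last => simp
    | cast j => simp [hx0, hy0]
  have hdir : ∀ i, 0 < A.symm e i * (y i - x i) := fun i => by
    have h1 := h.mul_pd_pos (fun _ => hx) one_pos hAv hx i
    have h2 := h.mul_pd_pos hq (sub_pos.2 hxy) hqe' hx i
    refine pos_of_mul_pos_left (b := pd (f (Fin.last (n + 1))) i x ^ 2) ?_ (sq_nonneg _)
    refine (mul_pos h1 h2).trans_eq ?_
    simp only [Pi.sub_apply]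
    ring
  have hright : ∀ᶠ t in 𝓝[>] (0 : ℝ), (fun j => f j (hF.localInverse _ _ _
      ((fun j => f j x) + t • e))) = (fun j => f j x) + t • e := by
    have hc : Tendsto (fun t : ℝ => (fun j => f j x) + t • e) (𝓝[>] 0) (𝓝 fun j => f j x) := by
      have := hline.continuousAt.tendsto
      rw [zero_smul, add_zero] at this
      exact this.mono_left nhdsWithin_le_nhds
    exact hc.eventually hF.eventually_right_inverse
  filter_upwards [eventually_mem_Icc_of_hasDerivAt hγ hγ0 hx hy hdir, hright] with t ht hrt
  refine ⟨_, ht, fun j => ?_, ?_⟩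
  · simpa [e, hx0] using congrFun hrt j.castSucc
  · simpa [e] using congrFun hrt (Fin.last (n + 1))

open Filter Topology in
/-- The intermediate value property of the last component on the common zero set of the others. -/
theorem exists_zero_of_nonpos_of_nonneg {a b : Fin (n + 2) → ℝ} (h : OMSystem n f (Set.Icc a b))
    (hf : ∀ j, C1On (f j) (Set.Icc a b)) {x y : Fin (n + 2) → ℝ} (hx : x ∈ Set.Icc a b)
    (hy : y ∈ Set.Icc a b) (hx0 : ∀ j : Fin (n + 1), f j.castSucc x = 0)
    (hy0 : ∀ j : Fin (n + 1), f j.castSucc y = 0)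
    (hxn : f (Fin.last (n + 1)) x ≤ 0) (hyn : 0 ≤ f (Fin.last (n + 1)) y) :
    ∃ p ∈ Set.Icc a b, ∀ j, f j p = 0 := by
  let G : (Fin (n + 2) → ℝ) → Fin (n + 2) → ℝ := fun w j => f j w
  let C : Set (Fin (n + 2) → ℝ) := {v | (∀ j : Fin (n + 1), v j.castSucc = 0) ∧
    v (Fin.last (n + 1)) ≤ 0}
  have hC : IsClosed C := by
    simp only [C, Set.ofPred_and, Set.ofPred_forall]
    exact (isClosed_iInter fun j => isClosed_eq (continuous_apply _) continuous_const).inter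
      (isClosed_le (continuous_apply _) continuous_const)
  have hG : ContinuousOn G (Set.Icc a b) := continuousOn_pi.2 fun j => (hf j).continuousOn
  have hK : IsCompact (Set.Icc a b ∩ G ⁻¹' C) :=
    isCompact_Icc.of_isClosed_subset (hG.preimage_isClosed_of_isClosed isClosed_Icc hC)
      Set.inter_subset_left
  obtain ⟨z, ⟨hz, hz0, hzn⟩, hmax⟩ := hK.exists_isMaxOn ⟨x, hx, hx0, hxn⟩
    ((hf (Fin.last (n + 1))).continuousOn.mono Set.inter_subset_left)
  rcases hzn.eq_or_lt with hzn | hzn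
  · exact ⟨z, hz, Fin.lastCases hzn hz0⟩
  · obtain ⟨t, ⟨w, hw, hw0, hwn⟩, ht, ht'⟩ :=
      ((h.eventually_exists_last_eq_add hf hz hy hz0 hy0 (hzn.trans_le hyn)).and
        (Ioo_mem_nhdsGT (neg_pos.2 hzn))).exists
    have hwz : f (Fin.last (n + 1)) w ≤ f (Fin.last (n + 1)) z :=
      hmax ⟨hw, hw0, by simp only [G] at ht' ⊢; linarith⟩
    linarith

end OMSystem

/-- Existence: if `F` is an O-M system on `B`, the curve `S = V(f_1,…,f_{n-1})`
meets `∂B` in exactly two distinct points `p₁ ≠ p₂`, and `f_n(p₁)·f_n(p₂) ≤ 0`,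
then `F` has exactly one zero in `B`. -/
theorem OMSystem.exists_unique_zero (n : ℕ) (a b : Fin (n+2) → ℝ)
    (hab : ∀ i, a i < b i) (f : Fin (n+2) → (Fin (n+2) → ℝ) → ℝ)
    (hC1 : ∀ j, C1On (f j) (Set.Icc a b))
    (hOM : OMSystem n f (Set.Icc a b))
    (p₁ p₂ : Fin (n+2) → ℝ) (hne : p₁ ≠ p₂)
    (hS : {x | ∀ j : Fin (n+1), f j.castSucc x = 0} ∩ frontier (Set.Icc a b) = {p₁, p₂})
    (hsign : f (Fin.last (n+1)) p₁ * f (Fin.last (n+1)) p₂ ≤ 0) :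
    ∃! p : Fin (n+2) → ℝ, p ∈ Set.Icc a b ∧ ∀ j, f j p = 0 := by
  have hmem : ∀ p ∈ ({p₁, p₂} : Set (Fin (n+2) → ℝ)),
      p ∈ Set.Icc a b ∧ ∀ j : Fin (n+1), f j.castSucc p = 0 := fun p hp => by
    rw [← hS] at hp
    exact ⟨isClosed_Icc.frontier_subset hp.2, hp.1⟩
  obtain ⟨h₁, h₁0⟩ := hmem p₁ (by simp)
  obtain ⟨h₂, h₂0⟩ := hmem p₂ (by simp)
  obtain ⟨p, hp, hp0⟩ : ∃ p ∈ Set.Icc a b, ∀ j, f j p = 0 := by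
    rcases mul_nonpos_iff.1 hsign with ⟨h, h'⟩ | ⟨h, h'⟩
    · exact hOM.exists_zero_of_nonpos_of_nonneg hC1 h₂ h₁ h₂0 h₁0 h' h
    · exact hOM.exists_zero_of_nonpos_of_nonneg hC1 h₁ h₂ h₁0 h₂0 h h'
  exact ⟨p, ⟨hp, hp0⟩, fun y hy => hOM.injOn hC1 (convex_Icc a b) hy.1 hp
    (funext fun j => (hy.2 j).trans (hp0 j).symm)⟩
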